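/- arXiv:1706.02643 — 3 statements merged into one kernel-verified Lean document; each statement's English description precedes it below -/
import Mathlib

section
/- Let U ⊆ ℝ² be an open connected set, f = (f₁, f₂) : U → ℝ² a C² map, and z₀ ∈ U a point with det Df(z₀) ≠ 0 and f(z₀) = (0,0). Then the Jacobian matrix of the vector field ∇H_f^⊥ at z₀ has trace equal to 0 and determinant equal to (det Df(z₀))² > 0; consequently its characteristic polynomial is X² + (det Df(z₀))² and its eigenvalues are purely imaginary (it has no real eigenvalue). -/
open Real Set

/-- Partial derivative in the `x` direction. -/
noncomputable def pdx (g : ℝ × ℝ → ℝ) (z : ℝ × ℝ) : ℝ := fderiv ℝ g z (1, 0)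

/-- Partial derivative in the `y` direction. -/
noncomputable def pdy (g : ℝ × ℝ → ℝ) (z : ℝ × ℝ) : ℝ := fderiv ℝ g z (0, 1)

/-- The Hamiltonian `H_f = (f₁² + f₂²)/2`. -/
noncomputable def Ham (f : ℝ × ℝ → ℝ × ℝ) (z : ℝ × ℝ) : ℝ :=
  ((f z).1 ^ 2 + (f z).2 ^ 2) / 2

/-- The Hamiltonian vector field `∇H_f^⊥ = (−∂H_f/∂y, ∂H_f/∂x)`. -/
noncomputable def hamVF (f : ℝ × ℝ → ℝ × ℝ) (z : ℝ × ℝ) : ℝ × ℝ :=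
  (-(pdy (Ham f) z), pdx (Ham f) z)

/-- The Jacobian determinant `det Df = ∂f₁/∂x ∂f₂/∂y − ∂f₂/∂x ∂f₁/∂y`. -/
noncomputable def jacDet (f : ℝ × ℝ → ℝ × ℝ) (z : ℝ × ℝ) : ℝ :=
  pdx (fun w => (f w).1) z * pdy (fun w => (f w).2) z -
    pdx (fun w => (f w).2) z * pdy (fun w => (f w).1) z

/-- `γ` is a periodic solution of the vector field `X` whose image is contained in `S`:
a non-constant `C¹` curve solving `γ' = X ∘ γ` with some period `T > 0`. -/
def IsPeriodicSolOn (X : ℝ × ℝ → ℝ × ℝ) (S : Set (ℝ × ℝ)) (γ : ℝ → ℝ × ℝ) : Prop :=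
  (∀ t, γ t ∈ S) ∧ (∀ t, HasDerivAt γ (X (γ t)) t) ∧
    (∃ T > 0, ∀ t, γ (t + T) = γ t) ∧ ∃ t s, γ t ≠ γ s

/-- The Euclidean norm on `ℝ²`. -/
noncomputable def euclNorm (w : ℝ × ℝ) : ℝ := Real.sqrt (w.1 ^ 2 + w.2 ^ 2)

/-- The open Euclidean disc of radius `r` centered at the origin. -/
def disc (r : ℝ) : Set (ℝ × ℝ) := {w | euclNorm w < r}

/-- `W` is the period annulus of the singular point `z₀` of the vector field `X` on `U`:
the maximal open connected subset of `U` containing `z₀` all whose points other than `z₀`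
lie on periodic solutions of `X` contained in `W`. -/
def IsPeriodAnnulus (X : ℝ × ℝ → ℝ × ℝ) (U : Set (ℝ × ℝ)) (z₀ : ℝ × ℝ)
    (W : Set (ℝ × ℝ)) : Prop :=
  z₀ ∈ W ∧ W ⊆ U ∧ IsOpen W ∧ IsConnected W ∧
    (∀ z ∈ W \ {z₀}, ∃ γ, IsPeriodicSolOn X W γ ∧ γ 0 = z) ∧
    ∀ W', z₀ ∈ W' → W' ⊆ U → IsOpen W' → IsConnected W' →
      (∀ z ∈ W' \ {z₀}, ∃ γ, IsPeriodicSolOn X W' γ ∧ γ 0 = z) → W ⊆ W' → W' = W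

theorem hasFDerivAt_fderiv_ham_apply {f : ℝ × ℝ → ℝ × ℝ} {z₀ : ℝ × ℝ}
    (hf : ContDiffAt ℝ 2 f z₀) (hfz : f z₀ = 0) (v : ℝ × ℝ) :
    HasFDerivAt (fun z => fderiv ℝ (Ham f) z v)
      (fderiv ℝ (fun w => (f w).1) z₀ v • fderiv ℝ (fun w => (f w).1) z₀ +
        fderiv ℝ (fun w => (f w).2) z₀ v • fderiv ℝ (fun w => (f w).2) z₀) z₀ := by
  have h₁ : ContDiffAt ℝ 2 (fun w => (f w).1) z₀ := hf.fst
  have h₂ : ContDiffAt ℝ 2 (fun w => (f w).2) z₀ := hf.snd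
  have formula : (fun z => fderiv ℝ (Ham f) z v) =ᶠ[nhds z₀] fun z =>
      (f z).1 * fderiv ℝ (fun w => (f w).1) z v +
        (f z).2 * fderiv ℝ (fun w => (f w).2) z v := by
    filter_upwards [h₁.eventually (by simp), h₂.eventually (by simp)] with z hz₁ hz₂
    have d₁ := (hz₁.differentiableAt (by simp)).hasFDerivAt
    have d₂ := (hz₂.differentiableAt (by simp)).hasFDerivAt
    have key : HasFDerivAt (Ham f) _ z := ((d₁.pow 2).add (d₂.pow 2)).mul_const (2⁻¹ : ℝ)
    rw [key.fderiv]
    simp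
    ring
  have deriv_apply {g : ℝ × ℝ → ℝ} (hg : ContDiffAt ℝ 2 g z₀) :
      DifferentiableAt ℝ (fun z => fderiv ℝ g z v) z₀ :=
    ((hg.fderiv_right (m := 1) (by norm_num)).differentiableAt (by simp)).clm_apply
      (differentiableAt_const v)
  have d₁ := (h₁.differentiableAt (by simp)).hasFDerivAt.mul (deriv_apply h₁).hasFDerivAt
  have d₂ := (h₂.differentiableAt (by simp)).hasFDerivAt.mul (deriv_apply h₂).hasFDerivAt
  refine HasFDerivAt.congr_of_eventuallyEq ((d₁.add d₂).congr_fderiv ?_) formula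
  simp [hfz]

theorem jacobian_matrix_of_hamVF (U : Set (ℝ × ℝ)) (hUo : IsOpen U) (hUc : IsConnected U)
    (f : ℝ × ℝ → ℝ × ℝ) (hf : ContDiffOn ℝ 2 f U)
    (z₀ : ℝ × ℝ) (hz₀ : z₀ ∈ U) (hdet : jacDet f z₀ ≠ 0) (hfz : f z₀ = (0, 0)) :
    ∀ J : Matrix (Fin 2) (Fin 2) ℝ,
      J = !![pdx (fun z => (hamVF f z).1) z₀, pdy (fun z => (hamVF f z).1) z₀;
             pdx (fun z => (hamVF f z).2) z₀, pdy (fun z => (hamVF f z).2) z₀] →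
      Matrix.trace J = 0 ∧ Matrix.det J = jacDet f z₀ ^ 2 ∧ 0 < jacDet f z₀ ^ 2 ∧
        Matrix.charpoly J = Polynomial.X ^ 2 + Polynomial.C (jacDet f z₀ ^ 2) ∧
        ∀ μ : ℝ, ¬Module.End.HasEigenvalue (Matrix.toLin' J) μ := by
  have hfa : ContDiffAt ℝ 2 f z₀ := hf.contDiffAt (hUo.mem_nhds hz₀)
  have hH := hasFDerivAt_fderiv_ham_apply hfa hfz
  have hx : fderiv ℝ (fun z => (hamVF f z).1) z₀ = _ := (hH (0, 1)).neg.fderiv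
  have hy : fderiv ℝ (fun z => (hamVF f z).2) z₀ = _ := (hH (1, 0)).fderiv
  intro J hJ
  have htr : J.trace = 0 := by
    simp only [hJ, Matrix.trace_fin_two_of, pdx, pdy, hx, hy]
    simp
    ring
  have hd : J.det = jacDet f z₀ ^ 2 := by
    simp only [hJ, Matrix.det_fin_two_of, jacDet, pdx, pdy, hx, hy]
    simp
    ring
  have hpos : 0 < jacDet f z₀ ^ 2 := by positivity
  have hchar : J.charpoly = Polynomial.X ^ 2 + Polynomial.C (jacDet f z₀ ^ 2) := by
    rw [Matrix.charpoly_fin_two, htr, hd]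
    simp
  refine ⟨htr, hd, hpos, hchar, fun μ hμ => ?_⟩
  rw [Module.End.hasEigenvalue_iff_isRoot_charpoly, Matrix.charpoly_toLin', hchar] at hμ
  simp only [Polynomial.IsRoot.def, Polynomial.eval_add, Polynomial.eval_pow, Polynomial.eval_X,
    Polynomial.eval_C] at hμ
  nlinarith [sq_nonneg μ]
end

section
/- Let U ⊆ ℝ² be an open connected set, f = (f₁, f₂) : U → ℝ² a C² map, and z₀ ∈ U a point with det Df(z₀) ≠ 0 and f(z₀) = (0,0). Then z₀ is a center of the Hamiltonian vector field ∇H_f^⊥: there exists an open neighborhood V ⊆ U of z₀ such that every point z ∈ V \ {z₀} lies on a periodic solution of ∇H_f^⊥ whose image is contained in V \ {z₀}. -/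
open Real Set

/-- The autonomous scalar equation `θ' = g θ` with `g` positive, continuous and `c`-periodic has a
global surjective solution starting at `0` that advances by `c` after a fixed time. -/
theorem exists_solution_of_periodic_pos (g : ℝ → ℝ) (c : ℝ) (hc : 0 < c) (hg : Continuous g)
    (hper : Function.Periodic g c) (hpos : ∀ x, 0 < g x) :
    ∃ θ : ℝ → ℝ, θ 0 = 0 ∧ (∀ t, HasDerivAt θ (g (θ t)) t) ∧ Function.Surjective θ ∧
      ∃ T ≠ 0, ∀ t, θ (t + T) = θ t + c := by
  have hcont : Continuous fun x => (g x)⁻¹ := hg.inv₀ fun x => (hpos x).ne'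
  have hper' : Function.Periodic (fun x => (g x)⁻¹) c := fun x => by simp only [hper x]
  have hint : ∀ a b, IntervalIntegrable (fun x => (g x)⁻¹) MeasureTheory.volume a b :=
    fun a b => hcont.intervalIntegrable a b
  have hpos' : ∀ x, 0 < (g x)⁻¹ := fun x => inv_pos.2 (hpos x)
  set G : ℝ → ℝ := fun x => ∫ s in (0 : ℝ)..x, (g s)⁻¹ with hG
  have hGd : ∀ x, HasDerivAt G (g x)⁻¹ x := fun x =>
    intervalIntegral.integral_hasDerivAt_right (hint _ _)
      (hcont.stronglyMeasurableAtFilter _ _) hcont.continuousAt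
  have hGm : StrictMono G := strictMono_of_hasDerivAt_pos hGd hpos'
  have hGc : Continuous G := continuous_iff_continuousAt.2 fun x => (hGd x).continuousAt
  have hGs : Function.Surjective G :=
    hGc.surjective (hper'.tendsto_atTop_intervalIntegral_of_pos' (hint 0 c) hpos' hc)
      (hper'.tendsto_atBot_intervalIntegral_of_pos' (hint 0 c) hpos' hc)
  have hG0 : G 0 = 0 := intervalIntegral.integral_same
  let e : ℝ ≃o ℝ := hGm.orderIsoOfSurjective G hGs
  have he : ∀ x, e x = G x := fun x => rfl
  refine ⟨e.symm, ?_, fun t => ?_, e.symm.surjective, G c, ?_, fun t => ?_⟩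
  · rw [OrderIso.symm_apply_eq, he, hG0]
  · have := HasDerivAt.of_local_left_inverse (f := G) (g := e.symm) (a := t)
      e.symm.continuous.continuousAt (hGd (e.symm t)) (hpos' _).ne'
      (Filter.Eventually.of_forall fun y => e.apply_symm_apply y)
    simpa using this
  · rw [← hG0]
    exact (hGm hc).ne'
  · rw [OrderIso.symm_apply_eq, he]
    obtain ⟨x, rfl⟩ := e.surjective t
    rw [e.symm_apply_apply, he]
    have h1 := hper'.intervalIntegral_add_eq 0 x
    have h2 := intervalIntegral.integral_add_adjacent_intervals (hint 0 x) (hint x (x + c))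
    simp only [hG, zero_add] at h1 ⊢
    rw [h1, h2]

/-- The autonomous scalar equation `θ' = g θ` with `g` nonvanishing, continuous and `c`-periodic has
a global surjective solution starting at `0` that advances by `c` after a fixed (signed) time. -/
theorem exists_solution_of_periodic_ne_zero (g : ℝ → ℝ) (c : ℝ) (hc : 0 < c) (hg : Continuous g)
    (hper : Function.Periodic g c) (hne : ∀ x, g x ≠ 0) :
    ∃ θ : ℝ → ℝ, θ 0 = 0 ∧ (∀ t, HasDerivAt θ (g (θ t)) t) ∧ Function.Surjective θ ∧
      ∃ T ≠ 0, ∀ t, θ (t + T) = θ t + c := by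
  have hsign : (∀ x, 0 < g x) ∨ ∀ x, g x < 0 := by
    by_contra! h
    obtain ⟨⟨a, ha⟩, b, hb⟩ := h
    obtain ⟨x, hx⟩ := mem_range_of_exists_le_of_exists_ge hg ⟨a, ha⟩ ⟨b, hb⟩
    exact hne x hx
  rcases hsign with hpos | hneg
  · exact exists_solution_of_periodic_pos g c hc hg hper hpos
  · obtain ⟨θ, h0, hd, hs, T, hT, hθ⟩ := exists_solution_of_periodic_pos (fun x => -g x) c hc
      hg.neg (fun x => by simp only [hper x]) fun x => neg_pos.2 (hneg x)
    refine ⟨fun t => θ (-t), by simpa using h0, fun t => ?_, fun x => ?_, -T, neg_ne_zero.2 hT,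
      fun t => ?_⟩
    · exact ((hd (-t)).scomp t (hasDerivAt_neg t)).congr_deriv (by simp)
    · obtain ⟨t, rfl⟩ := hs x
      exact ⟨-t, by simp⟩
    · simp only [← hθ, neg_add, neg_neg]

theorem pdx_fst {f : ℝ × ℝ → ℝ × ℝ} {z : ℝ × ℝ} (hf : DifferentiableAt ℝ f z) :
    pdx (fun w => (f w).1) z = (fderiv ℝ f z (1, 0)).1 := by
  simp [pdx, hf.hasFDerivAt.fst.fderiv]

theorem pdx_snd {f : ℝ × ℝ → ℝ × ℝ} {z : ℝ × ℝ} (hf : DifferentiableAt ℝ f z) :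
    pdx (fun w => (f w).2) z = (fderiv ℝ f z (1, 0)).2 := by
  simp [pdx, hf.hasFDerivAt.snd.fderiv]

theorem pdy_fst {f : ℝ × ℝ → ℝ × ℝ} {z : ℝ × ℝ} (hf : DifferentiableAt ℝ f z) :
    pdy (fun w => (f w).1) z = (fderiv ℝ f z (0, 1)).1 := by
  simp [pdy, hf.hasFDerivAt.fst.fderiv]

theorem pdy_snd {f : ℝ × ℝ → ℝ × ℝ} {z : ℝ × ℝ} (hf : DifferentiableAt ℝ f z) :
    pdy (fun w => (f w).2) z = (fderiv ℝ f z (0, 1)).2 := by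
  simp [pdy, hf.hasFDerivAt.snd.fderiv]

theorem jacDet_eq {f : ℝ × ℝ → ℝ × ℝ} {z : ℝ × ℝ} (hf : DifferentiableAt ℝ f z) :
    jacDet f z = (fderiv ℝ f z (1, 0)).1 * (fderiv ℝ f z (0, 1)).2 -
      (fderiv ℝ f z (1, 0)).2 * (fderiv ℝ f z (0, 1)).1 := by
  rw [jacDet, pdx_fst hf, pdx_snd hf, pdy_fst hf, pdy_snd hf]

theorem continuousOn_jacDet {f : ℝ × ℝ → ℝ × ℝ} {U : Set (ℝ × ℝ)} (hU : IsOpen U)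
    (hf : ContDiffOn ℝ 2 f U) : ContinuousOn (jacDet f) U := by
  have hL : ContinuousOn (fderiv ℝ f) U := hf.continuousOn_fderiv_of_isOpen hU (by norm_num)
  have h1 : ContinuousOn (fun z => fderiv ℝ f z (1, 0)) U := hL.clm_apply continuousOn_const
  have h2 : ContinuousOn (fun z => fderiv ℝ f z (0, 1)) U := hL.clm_apply continuousOn_const
  refine ContinuousOn.congr ((h1.fst.mul h2.snd).sub (h1.snd.mul h2.fst)) fun z hz => ?_
  exact jacDet_eq ((hf.differentiableOn (by norm_num)).differentiableAt (hU.mem_nhds hz))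

theorem apply_eq_fst_smul_add_snd_smul (L : ℝ × ℝ →L[ℝ] ℝ × ℝ) (v : ℝ × ℝ) :
    L v = v.1 • L (1, 0) + v.2 • L (0, 1) := by
  rw [← map_smul, ← map_smul, ← map_add]
  simp

theorem exists_continuousLinearEquiv_coe_eq_fderiv {f : ℝ × ℝ → ℝ × ℝ} {z : ℝ × ℝ}
    (hf : DifferentiableAt ℝ f z) (hdet : jacDet f z ≠ 0) :
    ∃ A : (ℝ × ℝ) ≃L[ℝ] ℝ × ℝ, (A : ℝ × ℝ →L[ℝ] ℝ × ℝ) = fderiv ℝ f z := by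
  rw [jacDet_eq hf] at hdet
  set L := fderiv ℝ f z
  have hinj : Function.Injective (L : ℝ × ℝ →ₗ[ℝ] ℝ × ℝ) := by
    refine (injective_iff_map_eq_zero _).2 fun v hv => ?_
    have hv' : L v = 0 := hv
    rw [apply_eq_fst_smul_add_snd_smul] at hv'
    have h1 := congrArg Prod.fst hv'
    have h2 := congrArg Prod.snd hv'
    simp only [Prod.fst_add, Prod.snd_add, Prod.smul_fst, Prod.smul_snd, smul_eq_mul,
      Prod.fst_zero, Prod.snd_zero] at h1 h2
    refine Prod.ext ((mul_eq_zero.1 ?_).resolve_right hdet) ((mul_eq_zero.1 ?_).resolve_right hdet)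
    · linear_combination (L (0, 1)).2 * h1 - (L (0, 1)).1 * h2
    · linear_combination (L (1, 0)).1 * h2 - (L (1, 0)).2 * h1
  refine ⟨(LinearEquiv.ofInjectiveEndo _ hinj).toContinuousLinearEquiv, ?_⟩
  ext <;> simp

/-- The differential of `f` maps the Hamiltonian vector field of `H_f` to the rotation field scaled
by the Jacobian determinant. -/
theorem fderiv_hamVF {f : ℝ × ℝ → ℝ × ℝ} {z : ℝ × ℝ} (hf : DifferentiableAt ℝ f z) :
    fderiv ℝ f z (hamVF f z) = jacDet f z • (-(f z).2, (f z).1) := by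
  have hH : HasFDerivAt (Ham f)
      ((f z).1 • (ContinuousLinearMap.fst ℝ ℝ ℝ).comp (fderiv ℝ f z) +
        (f z).2 • (ContinuousLinearMap.snd ℝ ℝ ℝ).comp (fderiv ℝ f z)) z := by
    have := ((hf.hasFDerivAt.fst.pow 2).add (hf.hasFDerivAt.snd.pow 2)).mul_const (1 / 2 : ℝ)
    refine (this.congr_fderiv ?_).congr_of_eventuallyEq (Filter.Eventually.of_forall fun w => ?_)
    · ext <;> simp <;> ring
    · simp [Ham]; ring
  rw [apply_eq_fst_smul_add_snd_smul, jacDet_eq hf]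
  ext <;> simp [hamVF, pdx, pdy, hH.fderiv] <;> ring

/-- The image of `w` under the rotation of angle `θ`. -/
noncomputable def rotate (w : ℝ × ℝ) (θ : ℝ) : ℝ × ℝ :=
  (w.1 * cos θ - w.2 * sin θ, w.1 * sin θ + w.2 * cos θ)

theorem hasDerivAt_rotate (w : ℝ × ℝ) (θ : ℝ) :
    HasDerivAt (rotate w) (-(rotate w θ).2, (rotate w θ).1) θ := by
  have h1 := ((hasDerivAt_cos θ).const_mul w.1).sub ((hasDerivAt_sin θ).const_mul w.2)
  have h2 := ((hasDerivAt_sin θ).const_mul w.1).add ((hasDerivAt_cos θ).const_mul w.2)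
  refine (h1.prodMk h2).congr_deriv ?_
  ext <;> simp [rotate] <;> ring

theorem rotate_normSq (w : ℝ × ℝ) (θ : ℝ) :
    (rotate w θ).1 ^ 2 + (rotate w θ).2 ^ 2 = w.1 ^ 2 + w.2 ^ 2 := by
  simp only [rotate]
  linear_combination (w.1 ^ 2 + w.2 ^ 2) * sin_sq_add_cos_sq θ

theorem rotate_periodic (w : ℝ × ℝ) : Function.Periodic (rotate w) (2 * π) := fun θ => by
  simp [rotate]

theorem exists_normSq_lt_subset {S : Set (ℝ × ℝ)} (hS : S ∈ nhds (0 : ℝ × ℝ)) :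
    ∃ ε > 0, {w : ℝ × ℝ | w.1 ^ 2 + w.2 ^ 2 < ε} ⊆ S := by
  obtain ⟨r, hr, hsub⟩ := Metric.mem_nhds_iff.1 hS
  refine ⟨r ^ 2, by positivity, fun w hw => hsub ?_⟩
  simp only [mem_ofPred_eq] at hw
  rw [mem_ball_zero_iff, Prod.norm_def, max_lt_iff, Real.norm_eq_abs, Real.norm_eq_abs]
  exact ⟨abs_lt_of_sq_lt_sq (by nlinarith [sq_nonneg w.2]) hr.le,
    abs_lt_of_sq_lt_sq (by nlinarith [sq_nonneg w.1]) hr.le⟩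

theorem is_center (U : Set (ℝ × ℝ)) (hUo : IsOpen U) (hUc : IsConnected U)
    (f : ℝ × ℝ → ℝ × ℝ) (hf : ContDiffOn ℝ 2 f U)
    (z₀ : ℝ × ℝ) (hz₀ : z₀ ∈ U) (hdet : jacDet f z₀ ≠ 0) (hfz : f z₀ = (0, 0)) :
    ∃ V, V ⊆ U ∧ IsOpen V ∧ z₀ ∈ V ∧
      ∀ z ∈ V \ {z₀}, ∃ γ, IsPeriodicSolOn (hamVF f) (V \ {z₀}) γ ∧ γ 0 = z := by
  have hdiff : ∀ z ∈ U, DifferentiableAt ℝ f z := fun z hz =>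
    (hf.differentiableOn (by norm_num)).differentiableAt (hUo.mem_nhds hz)
  have hjac := continuousOn_jacDet hUo hf
  obtain ⟨A, hA⟩ := exists_continuousLinearEquiv_coe_eq_fderiv (hdiff z₀ hz₀) hdet
  have hstrict : HasStrictFDerivAt f (A : ℝ × ℝ →L[ℝ] ℝ × ℝ) z₀ := by
    rw [hA]
    exact (hf.contDiffAt (hUo.mem_nhds hz₀)).hasStrictFDerivAt (by norm_num)
  let e := hstrict.toOpenPartialHomeomorph f
  have he : ∀ z, e z = f z := fun z => rfl
  have hsrc : z₀ ∈ e.source := hstrict.mem_toOpenPartialHomeomorph_source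
  have hf0 : f z₀ = 0 := hfz
  have h0t : (0 : ℝ × ℝ) ∈ e.target := by
    rw [← hf0]
    exact hstrict.image_mem_toOpenPartialHomeomorph_target
  have hsymm0 : e.symm 0 = z₀ := by
    rw [← hf0]
    exact e.left_inv hsrc
  have hU' : U ∩ jacDet f ⁻¹' {0}ᶜ ∈ nhds z₀ :=
    Filter.inter_mem (hUo.mem_nhds hz₀)
      ((hjac.continuousAt (hUo.mem_nhds hz₀)).preimage_mem_nhds
        (isOpen_compl_singleton.mem_nhds hdet))
  have hS : e.target ∩ e.symm ⁻¹' (U ∩ jacDet f ⁻¹' {0}ᶜ) ∈ nhds (0 : ℝ × ℝ) :=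
    Filter.inter_mem (e.open_target.mem_nhds h0t)
      ((e.symm.continuousAt h0t).preimage_mem_nhds (by rwa [hsymm0]))
  obtain ⟨ε, hε, hD⟩ := exists_normSq_lt_subset hS
  set D : Set (ℝ × ℝ) := {w | w.1 ^ 2 + w.2 ^ 2 < ε} with hDdef
  have hDo : IsOpen D := isOpen_lt (by fun_prop) continuous_const
  have h0D : (0 : ℝ × ℝ) ∈ D := by simpa [hDdef] using hε
  have hDt : D ⊆ e.target := fun w hw => (hD hw).1
  have hinj : ∀ w ∈ D, ∀ w' ∈ D, e.symm w = e.symm w' → w = w' := fun w hw w' hw' h =>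
    e.symm.injOn (hDt hw) (hDt hw') h
  refine ⟨e.symm '' D, ?_, e.symm.isOpen_image_of_subset_source hDo hDt, ⟨0, h0D, hsymm0⟩, ?_⟩
  · rintro _ ⟨w, hw, rfl⟩
    exact (hD hw).2.1
  rintro _ ⟨⟨w, hw, rfl⟩, hwz⟩
  have hw0 : 0 < w.1 ^ 2 + w.2 ^ 2 := by
    by_contra! h
    refine hwz ?_
    have h1 : w.1 = 0 := by nlinarith [sq_nonneg w.1, sq_nonneg w.2]
    have h2 : w.2 = 0 := by nlinarith [sq_nonneg w.1, sq_nonneg w.2]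
    have : w = 0 := Prod.ext h1 h2
    rw [this, hsymm0]
    rfl
  have hrD : ∀ x, rotate w x ∈ D := fun x => by
    simpa only [hDdef, mem_ofPred_eq, rotate_normSq] using hw
  have hrc : Continuous (rotate w) :=
    continuous_iff_continuousAt.2 fun x => (hasDerivAt_rotate w x).continuousAt
  have hφc : Continuous fun x => e.symm (rotate w x) :=
    e.symm.continuousOn.comp_continuous hrc fun x => hDt (hrD x)
  obtain ⟨θ, hθ0, hθd, hθs, T, hT, hθT⟩ := exists_solution_of_periodic_ne_zero
    (fun x => jacDet f (e.symm (rotate w x))) (2 * π) two_pi_pos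
    (hjac.comp_continuous hφc fun x => (hD (hrD x)).2.1)
    (fun x => by simp only [rotate_periodic w x]) (fun x => (hD (hrD x)).2.2)
  have hper : Function.Periodic (fun t => e.symm (rotate w (θ t))) T := fun t => by
    simp only [hθT, rotate_periodic w (θ t)]
  refine ⟨fun t => e.symm (rotate w (θ t)), ⟨fun t => ⟨mem_image_of_mem _ (hrD _), fun h => ?_⟩,
    fun t => ?_, ?_, ?_⟩, ?_⟩
  · have h0 : rotate w (θ t) = 0 := hinj _ (hrD _) _ h0D (by rw [hsymm0]; exact h)
    have := rotate_normSq w (θ t)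
    rw [h0] at this
    simp at this
    linarith
  · have hzU := (hD (hrD (θ t))).2
    have hft : f (e.symm (rotate w (θ t))) = rotate w (θ t) := e.right_inv (hDt (hrD _))
    obtain ⟨B, hB⟩ := exists_continuousLinearEquiv_coe_eq_fderiv (hdiff _ hzU.1) hzU.2
    have hinv : HasFDerivAt e.symm (B.symm : ℝ × ℝ →L[ℝ] ℝ × ℝ) (rotate w (θ t)) :=
      e.hasFDerivAt_symm (hDt (hrD _)) (by rw [hB]; exact (hdiff _ hzU.1).hasFDerivAt)
    refine (hinv.comp_hasDerivAt t ((hasDerivAt_rotate w (θ t)).scomp t (hθd t))).congr_deriv ?_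
    have hvf := fderiv_hamVF (hdiff _ hzU.1)
    rw [← hB, hft] at hvf
    rw [← hvf]
    exact B.symm_apply_apply _
  · rcases hT.lt_or_gt with h | h
    · exact ⟨-T, neg_pos.2 h, hper.neg⟩
    · exact ⟨T, h, hper⟩
  · obtain ⟨s, hs⟩ := hθs π
    refine ⟨0, s, fun h => ?_⟩
    have h' := hinj _ (hrD _) _ (hrD _) h
    rw [hθ0, hs] at h'
    simp only [rotate, cos_zero, sin_zero, cos_pi, sin_pi, Prod.mk.injEq] at h'
    have h1 : w.1 = 0 := by linarith [h'.1]
    have h2 : w.2 = 0 := by linarith [h'.2]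
    simp [h1, h2] at hw0
  · simp [hθ0, rotate]
end

section
/- Let U ⊆ ℝ² be an open connected set and f = (f₁, f₂) : U → ℝ² an injective C² map with det Df(z) ≠ 0 for every z ∈ U. Let h > 0 be such that the circle S_h = {w ∈ ℝ² : ‖w‖ = √(2h)} is contained in f(U). Then the level set H_f^{-1}{h} = {z ∈ U : H_f(z) = h} equals f^{-1}(S_h) and is homeomorphic to the unit circle in ℝ². -/
open Real Set

/-- At a point of differentiability, a nonzero Jacobian makes the derivative surjective. -/
lemma surjective_fderiv_of_jacDet_ne_zero {f : ℝ × ℝ → ℝ × ℝ} {z : ℝ × ℝ}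
    (hf : DifferentiableAt ℝ f z) (hz : jacDet f z ≠ 0) :
    Function.Surjective (fderiv ℝ f z) := by
  have h₁ : fderiv ℝ (fun w => (f w).1) z = (ContinuousLinearMap.fst ℝ ℝ ℝ).comp (fderiv ℝ f z) :=
    hf.hasFDerivAt.fst.fderiv
  have h₂ : fderiv ℝ (fun w => (f w).2) z = (ContinuousLinearMap.snd ℝ ℝ ℝ).comp (fderiv ℝ f z) :=
    hf.hasFDerivAt.snd.fderiv
  simp only [jacDet, pdx, pdy, h₁, h₂, ContinuousLinearMap.comp_apply,
    ContinuousLinearMap.coe_fst', ContinuousLinearMap.coe_snd'] at hz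
  set L := fderiv ℝ f z
  intro w
  set d := (L (1, 0)).1 * (L (0, 1)).2 - (L (1, 0)).2 * (L (0, 1)).1
  refine ⟨((w.1 * (L (0, 1)).2 - w.2 * (L (0, 1)).1) / d) • (1, 0) +
    (((L (1, 0)).1 * w.2 - (L (1, 0)).2 * w.1) / d) • (0, 1), ?_⟩
  rw [map_add, map_smul, map_smul]
  ext
  · simp only [Prod.fst_add, Prod.smul_fst, smul_eq_mul]
    field_simp
    ring
  · simp only [Prod.snd_add, Prod.smul_snd, smul_eq_mul]
    field_simp
    ring

/-- An injective `C¹` map with nonvanishing Jacobian on an open set is an open embedding. -/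
lemma isOpenEmbedding_domRestrict_of_jacDet_ne_zero {U : Set (ℝ × ℝ)} (hU : IsOpen U)
    {f : ℝ × ℝ → ℝ × ℝ} (hf : ContDiffOn ℝ 1 f U) (hinj : Set.InjOn f U)
    (hdet : ∀ z ∈ U, jacDet f z ≠ 0) : Topology.IsOpenEmbedding (U.domRestrict f) := by
  refine .of_continuous_injective_isOpenMap hf.continuousOn.domRestrict hinj.injective ?_
  rw [isOpenMap_iff_nhds_le]
  rintro ⟨z, hz⟩
  have hc : ContDiffAt ℝ 1 f z := hf.contDiffAt (hU.mem_nhds hz)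
  have hs := hc.hasStrictFDerivAt one_ne_zero
  have hmap := hs.map_nhds_eq_of_surj
    (LinearMap.range_eq_top.2
      (surjective_fderiv_of_jacDet_ne_zero hs.hasFDerivAt.differentiableAt (hdet z hz)))
  rw [Set.domRestrict_eq, ← Filter.map_map, map_nhds_subtype_coe_eq_nhds hz (hU.mem_nhds hz), hmap]
  rfl

lemma euclNorm_eq_sqrt_iff {w : ℝ × ℝ} {h : ℝ} (hh : 0 ≤ h) :
    euclNorm w = √(2 * h) ↔ (w.1 ^ 2 + w.2 ^ 2) / 2 = h := by
  rw [euclNorm, Real.sqrt_inj (by positivity) (by positivity), div_eq_iff two_ne_zero, mul_comm h]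

lemma euclNorm_smul (c : ℝ) (w : ℝ × ℝ) : euclNorm (c • w) = |c| * euclNorm w := by
  simp only [euclNorm, Prod.smul_fst, Prod.smul_snd, smul_eq_mul]
  rw [← Real.sqrt_sq_eq_abs, ← Real.sqrt_mul (sq_nonneg c)]
  congr 1
  ring

theorem level_set_is_topological_circle (U : Set (ℝ × ℝ)) (hUo : IsOpen U)
    (hUc : IsConnected U) (f : ℝ × ℝ → ℝ × ℝ) (hf : ContDiffOn ℝ 2 f U)
    (hinj : Set.InjOn f U) (hdet : ∀ z ∈ U, jacDet f z ≠ 0)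
    (h : ℝ) (hh : 0 < h)
    (hSh : {w : ℝ × ℝ | euclNorm w = Real.sqrt (2 * h)} ⊆ f '' U) :
    {z | z ∈ U ∧ Ham f z = h} =
        U ∩ f ⁻¹' {w : ℝ × ℝ | euclNorm w = Real.sqrt (2 * h)} ∧
      Nonempty ({z : ℝ × ℝ // z ∈ U ∧ Ham f z = h} ≃ₜ
        {w : ℝ × ℝ // euclNorm w = 1}) := by
  have hlevel (z : ℝ × ℝ) : Ham f z = h ↔ euclNorm (f z) = √(2 * h) :=
    (euclNorm_eq_sqrt_iff hh.le).symm
  refine ⟨Set.ext fun z => and_congr_right fun _ => hlevel z, ?_⟩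
  have hr : 0 < √(2 * h) := by positivity
  have hemb := isOpenEmbedding_domRestrict_of_jacDet_ne_zero hUo (hf.of_le one_le_two) hinj hdet
  have hg := (Homeomorph.smulOfNeZero (α := ℝ × ℝ) (√(2 * h))⁻¹
    (inv_ne_zero hr.ne')).isEmbedding.comp (hemb.isEmbedding.comp
      (Topology.IsEmbedding.inclusion (s := {z | z ∈ U ∧ Ham f z = h}) fun _ hz => hz.1))
  refine ⟨hg.toHomeomorph.trans (Homeomorph.setCongr (t := {w | euclNorm w = 1}) ?_)⟩
  ext w
  constructor
  · rintro ⟨⟨z, hz⟩, rfl⟩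
    change euclNorm ((√(2 * h))⁻¹ • f z) = 1
    rw [euclNorm_smul, (hlevel z).1 hz.2, abs_of_pos (inv_pos.2 hr), inv_mul_cancel₀ hr.ne']
  · intro (hw : euclNorm w = 1)
    obtain ⟨z, hzU, hz⟩ := @hSh (√(2 * h) • w) (by
      rw [mem_ofPred_eq, euclNorm_smul, hw, abs_of_pos hr, mul_one])
    refine ⟨⟨z, hzU, (hlevel z).2 ?_⟩, ?_⟩
    · rw [hz, euclNorm_smul, hw, abs_of_pos hr, mul_one]
    · change (√(2 * h))⁻¹ • f z = w
      rw [hz, inv_smul_smul₀ hr.ne']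
end
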